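/- arXiv:2404.13952 — 2 statements merged into one kernel-verified Lean document; each statement's English description precedes it below -/
import Mathlib

section
/- The four lattices L₁ = {(x,y) ∈ ℤ² : y ≡ 0 (mod 4)}, L₂ = {(x,y) ∈ ℤ² : x ≡ 0 (mod 2)}, L₃ = {(x,y) ∈ ℤ² : x ≡ y (mod 2)}, and L₄ = {(x,y) ∈ ℤ² : y ≡ 2x (mod 4)} (generated respectively by (1,0),(0,4); (2,0),(0,1); (1,1),(0,2); and (1,2),(0,4)) form a minimal covering of ℤ². -/
/-- The sublattice of ℤ² defined by the congruence `a·x₁ + b·x₂ ≡ 0 (mod n)`. -/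
def congLat (a b n : ℤ) : AddSubgroup (ℤ × ℤ) where
  carrier := {p : ℤ × ℤ | n ∣ a * p.1 + b * p.2}
  zero_mem' := by simp
  add_mem' := by
    intro p q hp hq
    simp only [Set.mem_setOf_eq, Prod.fst_add, Prod.snd_add] at *
    have e : a * (p.1 + q.1) + b * (p.2 + q.2)
        = (a * p.1 + b * p.2) + (a * q.1 + b * q.2) := by ring
    rw [e]; exact dvd_add hp hq
  neg_mem' := by
    intro p hp
    simp only [Set.mem_setOf_eq, Prod.fst_neg, Prod.snd_neg] at *
    have e : a * (-p.1) + b * (-p.2) = -(a * p.1 + b * p.2) := by ring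
    rw [e]; exact hp.neg_right

/-- A lattice: a finite-index (equivalently, rank-2) subgroup of ℤ². -/
def IsLattice (L : AddSubgroup (ℤ × ℤ)) : Prop := L.index ≠ 0

/-- A finite family of lattices covering ℤ². -/
def IsCovering {k : ℕ} (L : Fin k → AddSubgroup (ℤ × ℤ)) : Prop :=
  (∀ i, IsLattice (L i)) ∧ ∀ p : ℤ × ℤ, ∃ i, p ∈ L i

/-- A minimal covering of ℤ² by lattices: replacing any member by a proper
sublattice destroys the covering property. -/
def IsMinimalCovering {k : ℕ} (L : Fin k → AddSubgroup (ℤ × ℤ)) : Prop :=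
  IsCovering L ∧ ∀ (i : Fin k) (L' : AddSubgroup (ℤ × ℤ)),
    IsLattice L' → L' < L i → ¬ IsCovering (Function.update L i L')

theorem mem_congLat {a b n : ℤ} {p : ℤ × ℤ} : p ∈ congLat a b n ↔ n ∣ a * p.1 + b * p.2 :=
  Iff.rfl

theorem isLattice_congLat (a b : ℤ) (n : ℕ) [NeZero n] : IsLattice (congLat a b n) := by
  let f : ℤ × ℤ →+ ZMod n :=
    { toFun := fun p => ((a * p.1 + b * p.2 : ℤ) : ZMod n)
      map_zero' := by simp
      map_add' := by intro p q; push_cast [Prod.fst_add, Prod.snd_add]; ring }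
  have h : congLat a b n = f.ker := by
    ext p
    rw [mem_congLat, AddMonoidHom.mem_ker]
    exact (ZMod.intCast_zmod_eq_zero_iff_dvd _ n).symm
  unfold IsLattice
  rw [h, AddSubgroup.index_ker]
  exact Nat.ne_of_gt Nat.card_pos

/-- If `u`, `v` lie only in the `i`-th member and generate it, that member cannot be shrunk. -/
theorem not_covering_update {k : ℕ} (L : Fin k → AddSubgroup (ℤ × ℤ)) (i : Fin k)
    (L' : AddSubgroup (ℤ × ℤ)) (hlt : L' < L i) (u v : ℤ × ℤ)
    (hu : ∀ j, j ≠ i → u ∉ L j) (hv : ∀ j, j ≠ i → v ∉ L j)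
    (hgen : ∀ p ∈ L i, ∃ a b : ℤ, p = a • u + b • v) :
    ¬ IsCovering (Function.update L i L') := by
  rintro ⟨-, hc⟩
  have key : ∀ w : ℤ × ℤ, (∀ j, j ≠ i → w ∉ L j) → w ∈ L' := by
    intro w hw
    obtain ⟨j, hj⟩ := hc w
    by_cases hji : j = i
    · subst hji
      simpa using hj
    · rw [Function.update_of_ne hji] at hj
      exact absurd hj (hw j hji)
  apply hlt.not_ge
  intro p hp
  obtain ⟨a, b, rfl⟩ := hgen p hp
  exact L'.add_mem (L'.zsmul_mem (key u hu) a) (L'.zsmul_mem (key v hv) b)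

/-- The four lattices `{y ≡ 0 (4)}`, `{x ≡ 0 (2)}`, `{x ≡ y (2)}`, `{y ≡ 2x (4)}`
form a minimal covering of ℤ². -/
theorem minimal_covering_stmt :
    IsMinimalCovering ![congLat 0 1 4, congLat 1 0 2, congLat 1 (-1) 2, congLat (-2) 1 4] := by
  refine ⟨⟨?_, ?_⟩, ?_⟩
  · intro i
    fin_cases i
    · exact isLattice_congLat 0 1 4
    · exact isLattice_congLat 1 0 2
    · exact isLattice_congLat 1 (-1) 2
    · exact isLattice_congLat (-2) 1 4
  · rintro ⟨x, y⟩
    simp only [Fin.exists_fin_succ, Fin.exists_fin_zero_pi, Matrix.cons_val_zero,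
      Matrix.cons_val_succ, mem_congLat, IsEmpty.exists_iff]
    omega
  · intro i L' _ hlt
    fin_cases i
    · refine not_covering_update _ _ L' hlt (1, 0) (1, 4) ?_ ?_ ?_
      · intro j hj; fin_cases j <;> simp [mem_congLat] at hj ⊢ <;> omega
      · intro j hj; fin_cases j <;> simp [mem_congLat] at hj ⊢ <;> omega
      · rintro ⟨x, y⟩ hp
        have h : (4 : ℤ) ∣ 0 * x + 1 * y := hp
        obtain ⟨k, hk⟩ := h
        refine ⟨x - k, k, ?_⟩
        ext <;> simp <;> omega
    · refine not_covering_update _ _ L' hlt (0, 1) (2, 1) ?_ ?_ ?_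
      · intro j hj; fin_cases j <;> simp [mem_congLat] at hj ⊢ <;> omega
      · intro j hj; fin_cases j <;> simp [mem_congLat] at hj ⊢ <;> omega
      · rintro ⟨x, y⟩ hp
        have h : (2 : ℤ) ∣ 1 * x + 0 * y := hp
        obtain ⟨k, hk⟩ := h
        refine ⟨y - k, k, ?_⟩
        ext <;> simp <;> omega
    · refine not_covering_update _ _ L' hlt (1, 1) (1, -1) ?_ ?_ ?_
      · intro j hj; fin_cases j <;> simp [mem_congLat] at hj ⊢ <;> omega
      · intro j hj; fin_cases j <;> simp [mem_congLat] at hj ⊢ <;> omega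
      · rintro ⟨x, y⟩ hp
        have h : (2 : ℤ) ∣ 1 * x + (-1) * y := hp
        obtain ⟨k, hk⟩ := h
        refine ⟨x - k, k, ?_⟩
        ext <;> simp <;> omega
    · refine not_covering_update _ _ L' hlt (1, 2) (1, -2) ?_ ?_ ?_
      · intro j hj; fin_cases j <;> simp [mem_congLat] at hj ⊢ <;> omega
      · intro j hj; fin_cases j <;> simp [mem_congLat] at hj ⊢ <;> omega
      · rintro ⟨x, y⟩ hp
        have h : (4 : ℤ) ∣ (-2) * x + 1 * y := hp
        obtain ⟨k, hk⟩ := h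
        refine ⟨x + k, -k, ?_⟩
        ext <;> simp <;> omega
end

section
/- Let D and ν be positive integers with D | ν, 1 ≤ ν ≤ D², and Dν > 1, and let t₁,t₂,t₃,t₄ be integers with gcd(t₁,t₂,t₃,t₄) = 1 and d₂ := |t₁t₄ − t₂t₃| ≠ 0. Define the four subgroups of ℤ²: Λ₀ := {(x₁,x₂) : x₁ ≡ 0 (mod D) and νx₂ ≡ 0 (mod D)}; Λ₁ := {(x₁,x₂) : (t₁t₂+t₃t₄)x₁ + (t₂²+t₄²)x₂ ≡ 0 (mod d₂D) and ν((t₁²+t₃²)x₁ + (t₁t₂+t₃t₄)x₂) ≡ 0 (mod d₂D)}; Λ₂ := {(x₁,x₂) : (t₃t₄−t₁t₂)x₁ + (t₄²−t₂²)x₂ ≡ 0 (mod d₂D) and ν((t₁²−t₃²)x₁ + (t₁t₂−t₃t₄)x₂) ≡ 0 (mod d₂D)}; Λ₃ := {(x₁,x₂) : (t₂t₃+t₁t₄)x₁ + 2t₂t₄x₂ ≡ 0 (mod d₂D) and ν(2t₁t₃x₁ + (t₂t₃+t₁t₄)x₂) ≡ 0 (mod d₂D)}. If Λ₀ ∪ Λ₁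 ∪ Λ₂ ∪ Λ₃ = ℤ² and Λᵢ ≠ ℤ² for all i ∈ {0,1,2,3}, then D ≠ 3. -/
/-- `Λ₀ = {(x₁,x₂) : x₁ ≡ 0 (mod D), ν·x₂ ≡ 0 (mod D)}`. -/
def Lam0 (D ν : ℤ) : AddSubgroup (ℤ × ℤ) := congLat 1 0 D ⊓ congLat 0 ν D

/-- `Λ₁`, cut out by `(t₁t₂+t₃t₄)x₁ + (t₂²+t₄²)x₂ ≡ 0` and
`ν((t₁²+t₃²)x₁ + (t₁t₂+t₃t₄)x₂) ≡ 0 (mod d₂D)`, where `d₂ = |t₁t₄ - t₂t₃|`. -/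
def Lam1 (D ν t1 t2 t3 t4 : ℤ) : AddSubgroup (ℤ × ℤ) :=
  congLat (t1 * t2 + t3 * t4) (t2 ^ 2 + t4 ^ 2) (|t1 * t4 - t2 * t3| * D) ⊓
    congLat (ν * (t1 ^ 2 + t3 ^ 2)) (ν * (t1 * t2 + t3 * t4)) (|t1 * t4 - t2 * t3| * D)

/-- `Λ₂`, cut out by `(t₃t₄-t₁t₂)x₁ + (t₄²-t₂²)x₂ ≡ 0` and
`ν((t₁²-t₃²)x₁ + (t₁t₂-t₃t₄)x₂) ≡ 0 (mod d₂D)`. -/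
def Lam2 (D ν t1 t2 t3 t4 : ℤ) : AddSubgroup (ℤ × ℤ) :=
  congLat (t3 * t4 - t1 * t2) (t4 ^ 2 - t2 ^ 2) (|t1 * t4 - t2 * t3| * D) ⊓
    congLat (ν * (t1 ^ 2 - t3 ^ 2)) (ν * (t1 * t2 - t3 * t4)) (|t1 * t4 - t2 * t3| * D)

/-- `Λ₃`, cut out by `(t₂t₃+t₁t₄)x₁ + 2t₂t₄x₂ ≡ 0` and
`ν(2t₁t₃x₁ + (t₂t₃+t₁t₄)x₂) ≡ 0 (mod d₂D)`. -/
def Lam3 (D ν t1 t2 t3 t4 : ℤ) : AddSubgroup (ℤ × ℤ) :=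
  congLat (t2 * t3 + t1 * t4) (2 * t2 * t4) (|t1 * t4 - t2 * t3| * D) ⊓
    congLat (ν * (2 * t1 * t3)) (ν * (t2 * t3 + t1 * t4)) (|t1 * t4 - t2 * t3| * D)

theorem cl_mem (a b n : ℤ) (p : ℤ × ℤ) : p ∈ congLat a b n ↔ n ∣ a * p.1 + b * p.2 := Iff.rfl

/-- Two congruences with the same modulus. -/
def twoLat (a b c d n : ℤ) : AddSubgroup (ℤ × ℤ) := congLat a b n ⊓ congLat c d n

theorem tl_mem (a b c d n : ℤ) (p : ℤ × ℤ) :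
    p ∈ twoLat a b c d n ↔ (n ∣ a * p.1 + b * p.2 ∧ n ∣ c * p.1 + d * p.2) := Iff.rfl

theorem tl_smul (a b c d n m : ℤ) (h : n ∣ m) (p : ℤ × ℤ) : m • p ∈ twoLat a b c d n := by
  rw [tl_mem]
  simp only [Prod.smul_fst, Prod.smul_snd, smul_eq_mul]
  exact ⟨h.trans ⟨a * p.1 + b * p.2, by ring⟩, h.trans ⟨c * p.1 + d * p.2, by ring⟩⟩

theorem tl_split (a b c d P e : ℤ) (h : IsCoprime P e) (p : ℤ × ℤ) :
    p ∈ twoLat a b c d (P * e) ↔ p ∈ twoLat a b c d P ∧ p ∈ twoLat a b c d e := by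
  simp only [tl_mem]
  constructor
  · rintro ⟨h1, h2⟩
    exact ⟨⟨(Dvd.intro _ rfl).trans h1, (Dvd.intro _ rfl).trans h2⟩,
      ⟨(Dvd.intro_left _ rfl).trans h1, (Dvd.intro_left _ rfl).trans h2⟩⟩
  · rintro ⟨⟨h1, h2⟩, h3, h4⟩
    exact ⟨h.mul_dvd h1 h3, h.mul_dvd h2 h4⟩

/-- A subgroup of 3-power index containing two vectors independent mod 3 is everything. -/
theorem nak (L : AddSubgroup (ℤ × ℤ)) (s : ℕ) (hs : ∀ z : ℤ × ℤ, (3 ^ s : ℤ) • z ∈ L)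
    (hL : L ≠ ⊤) (u v : ℤ × ℤ) (hu : u ∈ L) (hv : v ∈ L) : (3 : ℤ) ∣ u.1 * v.2 - u.2 * v.1 := by
  by_contra hd
  apply hL
  rw [eq_top_iff]
  intro x _
  have hc : IsCoprime ((3 : ℤ) ^ s) (u.1 * v.2 - u.2 * v.1) :=
    ((Int.prime_three.coprime_iff_not_dvd).2 hd).pow_left
  obtain ⟨a, b, hab⟩ := hc
  have : x = (3 ^ s : ℤ) • (a • x) + ((b * (x.1 * v.2 - x.2 * v.1)) • u
      + (b * (x.2 * u.1 - x.1 * u.2)) • v) := by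
    ext
    · simp only [Prod.fst_add, Prod.smul_fst, smul_eq_mul]
      linear_combination (-x.1) * hab
    · simp only [Prod.snd_add, Prod.smul_snd, smul_eq_mul]
      linear_combination (-x.2) * hab
  rw [this]
  exact L.add_mem (hs _) (L.add_mem (L.zsmul_mem hu _) (L.zsmul_mem hv _))

def vv : Fin 4 → ℤ × ℤ := ![(0, 1), (1, 0), (1, 1), (1, -1)]

theorem vv_det (i j : Fin 4) (z : ℤ × ℤ)
    (h : (3 : ℤ) ∣ (vv i + (3 : ℤ) • z).1 * (vv j).2 - (vv i + (3 : ℤ) • z).2 * (vv j).1) :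
    i = j := by
  fin_cases i <;> fin_cases j <;> simp [vv] at h ⊢ <;> omega

theorem cover3 (L : Fin 4 → AddSubgroup (ℤ × ℤ)) (s : ℕ)
    (hs : ∀ i, ∀ z : ℤ × ℤ, (3 ^ s : ℤ) • z ∈ L i) (hL : ∀ i, L i ≠ ⊤)
    (hc : ∀ x, ∃ i, x ∈ L i) :
    (∀ i, ∀ z : ℤ × ℤ, (3 : ℤ) • z ∈ L i) ∧
      ∀ i j, ((0, 1) : ℤ × ℤ) ∈ L i → ((0, 1) : ℤ × ℤ) ∈ L j → i = j := by
  choose σ hσ using fun j => hc (vv j)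
  have inj : Function.Injective σ := by
    intro i j hij
    apply vv_det i j 0
    rw [smul_zero, add_zero]
    exact nak (L (σ i)) s (hs _) (hL _) _ _ (hσ i) (hij ▸ hσ j)
  have surj : Function.Surjective σ := Finite.injective_iff_surjective.1 inj
  have key : ∀ i, ((0, 1) : ℤ × ℤ) ∈ L i → i = σ 0 := by
    intro i hi
    obtain ⟨j, rfl⟩ := surj i
    have : (0 : Fin 4) = j := by
      apply vv_det 0 j 0
      rw [smul_zero, add_zero]
      exact nak (L (σ j)) s (hs _) (hL _) _ _ hi (hσ j)
    rw [this]
  refine ⟨fun i z => ?_, fun i j hi hj => (key i hi).trans (key j hj).symm⟩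
  obtain ⟨j, rfl⟩ := surj i
  obtain ⟨i', hi'⟩ := hc (vv j + (3 : ℤ) • z)
  obtain ⟨j', rfl⟩ := surj i'
  have : j = j' := vv_det j j' z (nak _ s (hs _) (hL _) _ _ hi' (hσ j'))
  subst this
  have := (L (σ j)).sub_mem hi' (hσ j)
  simpa using this

theorem two_cover (A B : AddSubgroup (ℤ × ℤ)) (hA : A ≠ ⊤) (hB : B ≠ ⊤) :
    ∃ x, x ∉ A ∧ x ∉ B := by
  by_contra! h
  obtain ⟨a, ha⟩ : ∃ a, a ∉ A := by
    by_contra! h'; exact hA (eq_top_iff.2 fun x _ => h' x)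
  obtain ⟨b, hb⟩ : ∃ a, a ∉ B := by
    by_contra! h'; exact hB (eq_top_iff.2 fun x _ => h' x)
  have haB := h a ha
  have hbA : b ∈ A := by by_contra h'; exact hb (h b h')
  by_cases hab : a + b ∈ A
  · exact ha (by simpa using A.sub_mem hab hbA)
  · exact hb (by simpa using B.sub_mem (h _ hab) haB)

theorem three_aux (A B C : AddSubgroup (ℤ × ℤ)) (hA : A ≠ ⊤) (hB : B ≠ ⊤) (hC : C ≠ ⊤)
    (h : ∀ x, x ∈ A ∨ x ∈ B ∨ x ∈ C) (x : ℤ × ℤ) (hx : x ∈ A) (hxB : x ∉ B) : x + x ∈ B := by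
  obtain ⟨b, hb1, hb2⟩ := two_cover A C hA hC
  have hbB : b ∈ B := by have := h b; tauto
  obtain ⟨c, hc1, hc2⟩ := two_cover A B hA hB
  have hcC : c ∈ C := by have := h c; tauto
  -- `x + b` lies in `C`
  have h1 : x + b ∉ A := fun h' => hb1 (by simpa using A.sub_mem h' hx)
  have h2 : x + b ∉ B := fun h' => hxB (by simpa using B.sub_mem h' hbB)
  have h3 : x + b ∈ C := by have := h (x + b); tauto
  have hxC : x ∉ C := fun h' => hb2 (by simpa using C.sub_mem h3 h')
  have h4 : x + (x + b) ∉ A := fun h' => h1 (by simpa using A.sub_mem h' hx)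
  have h5 : x + (x + b) ∉ C := fun h' => hxC (by simpa using C.sub_mem h' h3)
  have h6 : x + (x + b) ∈ B := by have := h (x + (x + b)); tauto
  have := B.sub_mem h6 hbB
  have e : x + (x + b) - b = x + x := by abel
  rwa [e] at this

theorem three_mem (A B C : AddSubgroup (ℤ × ℤ)) (hA : A ≠ ⊤) (hB : B ≠ ⊤) (hC : C ≠ ⊤)
    (h : ∀ x, x ∈ A ∨ x ∈ B ∨ x ∈ C) (x : ℤ × ℤ) : x + x ∈ B := by
  by_cases hxB : x ∈ B
  · exact B.add_mem hxB hxB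
  · rcases h x with hx | hx | hx
    · exact three_aux A B C hA hB hC h x hx hxB
    · exact absurd hx hxB
    · exact three_aux C B A hC hB hA (fun y => by have := h y; tauto) x hx hxB

theorem odd_cancel (r : ℕ) (x : ℤ) (h : (3 : ℤ) ^ r ∣ 2 * x) : (3 : ℤ) ^ r ∣ x :=
  (IsCoprime.pow_left (by norm_num : IsCoprime (3 : ℤ) 2)).dvd_of_dvd_mul_left h

theorem three_cancel (r : ℕ) (t x : ℤ) (ht : ¬ (3 : ℤ) ∣ t) (h : (3 : ℤ) ^ r ∣ t * x) :
    (3 : ℤ) ^ r ∣ x :=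
  (IsCoprime.pow_left ((Int.prime_three.coprime_iff_not_dvd).2 ht)).dvd_of_dvd_mul_left h

/-- Key 3-adic computation. -/
theorem arith (r : ℕ) (hr : r ≠ 0) (t1 t2 t3 t4 : ℤ)
    (hg : ¬ ((3 : ℤ) ∣ t1 ∧ (3 : ℤ) ∣ t2 ∧ (3 : ℤ) ∣ t3 ∧ (3 : ℤ) ∣ t4))
    (h1 : (3 : ℤ) ^ r ∣ t1 * t2 + t3 * t4) (h2 : (3 : ℤ) ^ r ∣ t2 ^ 2 + t4 ^ 2)
    (h3 : (3 : ℤ) ^ r ∣ t3 * t4 - t1 * t2) (h4 : (3 : ℤ) ^ r ∣ t4 ^ 2 - t2 ^ 2)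
    (h5 : (3 : ℤ) ^ r ∣ t2 * t3 + t1 * t4)
    (h6 : ¬ (3 : ℤ) ∣ t1 → (3 : ℤ) ^ r ∣ t2 → (3 : ℤ) ^ r ∣ t1 * t4)
    (h7 : ¬ (3 : ℤ) ∣ t3 → (3 : ℤ) ^ r ∣ t4 → (3 : ℤ) ^ r ∣ t2 * t3) :
    (3 : ℤ) ^ r ∣ t2 ∧ (3 : ℤ) ^ r ∣ t4 := by
  have a1 : (3 : ℤ) ^ r ∣ t1 * t2 := odd_cancel r _ ((dvd_sub h1 h3).trans (dvd_of_eq (by ring)))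
  have a2 : (3 : ℤ) ^ r ∣ t3 * t4 := odd_cancel r _ ((dvd_add h1 h3).trans (dvd_of_eq (by ring)))
  have a3 : (3 : ℤ) ^ r ∣ t2 ^ 2 := odd_cancel r _ ((dvd_sub h2 h4).trans (dvd_of_eq (by ring)))
  have a4 : (3 : ℤ) ^ r ∣ t4 ^ 2 := odd_cancel r _ ((dvd_add h2 h4).trans (dvd_of_eq (by ring)))
  have b2 : (3 : ℤ) ∣ t2 := Int.prime_three.dvd_of_dvd_pow ((dvd_pow_self 3 hr).trans a3)
  have b4 : (3 : ℤ) ∣ t4 := Int.prime_three.dvd_of_dvd_pow ((dvd_pow_self 3 hr).trans a4)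
  by_cases c1 : (3 : ℤ) ∣ t1
  · have c3 : ¬ (3 : ℤ) ∣ t3 := fun c3 => hg ⟨c1, b2, c3, b4⟩
    have d4 := three_cancel r _ _ c3 a2
    exact ⟨three_cancel r _ _ c3 (by rw [mul_comm]; exact h7 c3 d4), d4⟩
  · have d2 := three_cancel r _ _ c1 a1
    exact ⟨d2, three_cancel r _ _ c1 (h6 c1 d2)⟩

theorem final_three (ν t1 t2 t3 t4 : ℤ) (hdvd : (3 : ℤ) ∣ ν)
    (hg : ¬ ((3 : ℤ) ∣ t1 ∧ (3 : ℤ) ∣ t2 ∧ (3 : ℤ) ∣ t3 ∧ (3 : ℤ) ∣ t4))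
    (r : ℕ) (f : ℤ) (hf : ¬ (3 : ℤ) ∣ f) (hdf : t1 * t4 - t2 * t3 = 3 ^ r * f)
    (L : Fin 4 → AddSubgroup (ℤ × ℤ))
    (hL1 : L 1 = twoLat (t1 * t2 + t3 * t4) (t2 ^ 2 + t4 ^ 2)
      (ν * (t1 ^ 2 + t3 ^ 2)) (ν * (t1 * t2 + t3 * t4)) (3 ^ (r + 1)))
    (hL2 : L 2 = twoLat (t3 * t4 - t1 * t2) (t4 ^ 2 - t2 ^ 2)
      (ν * (t1 ^ 2 - t3 ^ 2)) (ν * (t1 * t2 - t3 * t4)) (3 ^ (r + 1)))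
    (hL3 : L 3 = twoLat (t2 * t3 + t1 * t4) (2 * t2 * t4)
      (ν * (2 * t1 * t3)) (ν * (t2 * t3 + t1 * t4)) (3 ^ (r + 1)))
    (h3 : ∀ i, ∀ z : ℤ × ℤ, (3 : ℤ) • z ∈ L i)
    (h01 : ∀ i, i ≠ 0 → ((0, 1) : ℤ × ℤ) ∉ L i) : False := by
  have n1 := h01 1 (by decide)
  have n2 := h01 2 (by decide)
  have n3 := h01 3 (by decide)
  rw [hL1, tl_mem] at n1
  rw [hL2, tl_mem] at n2
  rw [hL3, tl_mem] at n3
  simp only [mul_zero, mul_one, zero_add] at n1 n2 n3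
  rcases Nat.eq_zero_or_pos r with rfl | hr
  · simp only [zero_add, pow_one] at n1 n2 n3
    have n2' : ¬ (3 : ℤ) ∣ t4 ^ 2 - t2 ^ 2 := fun h => n2 ⟨h, hdvd.mul_right _⟩
    have n3' : ¬ (3 : ℤ) ∣ 2 * t2 * t4 := fun h => n3 ⟨h, hdvd.mul_right _⟩
    have c2 : ¬ (3 : ℤ) ∣ t2 := fun h => n3' ((h.mul_left 2).mul_right t4)
    have c4 : ¬ (3 : ℤ) ∣ t4 := fun h => n3' (h.mul_left _)
    have e : t4 ^ 2 - t2 ^ 2 = (t4 - t2) * (t4 + t2) := by ring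
    rw [e] at n2'
    have : (3 : ℤ) ∣ t4 - t2 ∨ (3 : ℤ) ∣ t4 + t2 := by
      clear n1 n2 n3 n2' n3' e
      have k2 : t2 % 3 = 1 ∨ t2 % 3 = 2 := by omega
      have k4 : t4 % 3 = 1 ∨ t4 % 3 = 2 := by omega
      rcases k2 with k2 | k2 <;> rcases k4 with k4 | k4 <;> omega
    rcases this with h | h
    · exact n2' (h.mul_right _)
    · exact n2' (h.mul_left _)
  · have m1 := h3 1 (1, 0)
    have m1' := h3 1 (0, 1)
    have m2 := h3 2 (1, 0)
    have m2' := h3 2 (0, 1)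
    have m3 := h3 3 (1, 0)
    rw [hL1, tl_mem] at m1 m1'
    rw [hL2, tl_mem] at m2 m2'
    rw [hL3, tl_mem] at m3
    simp only [Prod.smul_mk, smul_eq_mul, mul_zero, mul_one, zero_add, add_zero] at m1 m1' m2 m2' m3
    have can : ∀ x : ℤ, (3 : ℤ) ^ (r + 1) ∣ x * 3 → (3 : ℤ) ^ r ∣ x := by
      intro x hx
      rw [pow_succ] at hx
      exact Int.dvd_of_mul_dvd_mul_right (by norm_num) hx
    have hd : (3 : ℤ) ^ r ∣ t1 * t4 - t2 * t3 := ⟨f, hdf⟩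
    have h5 := can _ m3.1
    obtain ⟨q2, q4⟩ := arith r (by omega) t1 t2 t3 t4 hg (can _ m1.1) (can _ m1'.1) (can _ m2.1)
      (can _ m2'.1) h5
      (fun _ _ => odd_cancel r _ ((dvd_add h5 hd).trans (dvd_of_eq (by ring))))
      (fun _ _ => odd_cancel r _ ((dvd_sub h5 hd).trans (dvd_of_eq (by ring))))
    apply n1
    have hrr : (3 : ℤ) ^ (r + 1) ∣ (3 ^ r) ^ 2 := by
      rw [← pow_mul]; exact pow_dvd_pow _ (by omega)
    refine ⟨dvd_add (hrr.trans (pow_dvd_pow_of_dvd q2 2)) (hrr.trans (pow_dvd_pow_of_dvd q4 2)), ?_⟩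
    rw [pow_succ, mul_comm]
    exact mul_dvd_mul hdvd (dvd_add (q2.mul_left _) (q4.mul_left _))

theorem final_two (ν t1 t2 t3 t4 : ℤ)
    (hg : ¬ ((3 : ℤ) ∣ t1 ∧ (3 : ℤ) ∣ t2 ∧ (3 : ℤ) ∣ t3 ∧ (3 : ℤ) ∣ t4))
    (r : ℕ) (f : ℤ) (hf : ¬ (3 : ℤ) ∣ f) (hdf : t1 * t4 - t2 * t3 = 3 ^ r * f)
    (N : ℤ) (hN : (3 : ℤ) ^ (r + 1) ∣ N)
    (h1 : ∀ x, x + x ∈ twoLat (t1 * t2 + t3 * t4) (t2 ^ 2 + t4 ^ 2)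
      (ν * (t1 ^ 2 + t3 ^ 2)) (ν * (t1 * t2 + t3 * t4)) N)
    (h2 : ∀ x, x + x ∈ twoLat (t3 * t4 - t1 * t2) (t4 ^ 2 - t2 ^ 2)
      (ν * (t1 ^ 2 - t3 ^ 2)) (ν * (t1 * t2 - t3 * t4)) N)
    (h3 : ∀ x, x + x ∈ twoLat (t2 * t3 + t1 * t4) (2 * t2 * t4)
      (ν * (2 * t1 * t3)) (ν * (t2 * t3 + t1 * t4)) N) : False := by
  have m1 := (h1 (1, 0)).1
  have m1' := (h1 (0, 1)).1
  have m2 := (h2 (1, 0)).1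
  have m2' := (h2 (0, 1)).1
  have m3 := (h3 (1, 0)).1
  simp only [SetLike.mem_coe, AddSubgroup.mem_toAddSubmonoid, cl_mem] at m1 m1' m2 m2' m3
  change N ∣ _ at m1 m1' m2 m2' m3
  simp only [Prod.mk_add_mk, mul_zero, add_zero, zero_add] at m1 m1' m2 m2' m3
  have can : ∀ x : ℤ, N ∣ x * (1 + 1) → (3 : ℤ) ^ (r + 1) ∣ x := by
    intro x hx
    exact odd_cancel _ _ (hN.trans ((hx).trans (dvd_of_eq (by ring))))
  have h5 := can _ m3
  obtain ⟨q2, q4⟩ := arith (r + 1) (by omega) t1 t2 t3 t4 hg (can _ m1) (can _ m1') (can _ m2)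
      (can _ m2') h5
      (fun _ h => (dvd_add_right (h.mul_right _)).1 h5)
      (fun _ h => (dvd_add_left (h.mul_left _)).1 h5)
  have : (3 : ℤ) ^ (r + 1) ∣ 3 ^ r * f := by
    rw [← hdf]; exact dvd_sub (q4.mul_left _) (q2.mul_right _)
  rw [pow_succ] at this
  exact hf (Int.dvd_of_mul_dvd_mul_left (by positivity) this)

/-- Passing from the covering by `H0` and `twoLat … (P * e)` to its 3-adic part. -/
theorem transfer (b P e : ℤ) (hP : P ∣ b - 1) (he : e ∣ b) (hPe : IsCoprime P e)
    (α β γ δ : ℤ) (p x : ℤ × ℤ) (hp : p ∉ twoLat α β γ δ (P * e))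
    (hw : p + b • (x - p) ∈ twoLat α β γ δ (P * e)) :
    p ∉ twoLat α β γ δ P ∧ x ∈ twoLat α β γ δ P := by
  rw [tl_split _ _ _ _ _ _ hPe] at hp hw
  have h1 : p ∈ twoLat α β γ δ e := by
    have := (twoLat α β γ δ e).sub_mem hw.2 (tl_smul α β γ δ e b he (x - p))
    simpa using this
  refine ⟨fun h => hp ⟨h, h1⟩, ?_⟩
  have := (twoLat α β γ δ P).sub_mem hw.1 (tl_smul α β γ δ P (b - 1) hP (x - p))
  have e : p + b • (x - p) - (b - 1) • (x - p) = x := by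
    rw [sub_smul, one_smul]; abel
  rwa [e] at this

/-- If the four lattices `Λ₀, Λ₁, Λ₂, Λ₃` cover ℤ² and none of them equals ℤ²,
then `D ≠ 3`. -/
theorem lattice_covering_stmt (D ν t1 t2 t3 t4 : ℤ)
    (hD : 0 < D) (hν : 0 < ν) (hdvd : D ∣ ν) (hle : ν ≤ D ^ 2) (hgt : 1 < D * ν)
    (hgcd : Int.gcd (Int.gcd (Int.gcd t1 t2) t3) t4 = 1)
    (hd2 : t1 * t4 - t2 * t3 ≠ 0)
    (hcover : ∀ p : ℤ × ℤ, p ∈ Lam0 D ν ∨ p ∈ Lam1 D ν t1 t2 t3 t4 ∨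
      p ∈ Lam2 D ν t1 t2 t3 t4 ∨ p ∈ Lam3 D ν t1 t2 t3 t4)
    (hproper : Lam0 D ν ≠ ⊤ ∧ Lam1 D ν t1 t2 t3 t4 ≠ ⊤ ∧
      Lam2 D ν t1 t2 t3 t4 ≠ ⊤ ∧ Lam3 D ν t1 t2 t3 t4 ≠ ⊤) :
    D ≠ 3 := by
  rintro rfl
  obtain ⟨-, p1, p2, p3⟩ := hproper
  have hg : ¬ ((3 : ℤ) ∣ t1 ∧ (3 : ℤ) ∣ t2 ∧ (3 : ℤ) ∣ t3 ∧ (3 : ℤ) ∣ t4) := by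
    rintro ⟨a, b, c, d⟩
    have := Int.dvd_coe_gcd (Int.dvd_coe_gcd (Int.dvd_coe_gcd a b) c) d
    rw [hgcd] at this
    norm_num at this
  obtain ⟨r, f, hf, hdf⟩ : ∃ (r : ℕ) (f : ℤ), ¬ (3 : ℤ) ∣ f ∧ t1 * t4 - t2 * t3 = 3 ^ r * f := by
    have hfin : FiniteMultiplicity (3 : ℤ) (t1 * t4 - t2 * t3) :=
      Int.finiteMultiplicity_iff.2 ⟨by decide, hd2⟩
    obtain ⟨f, h1, h2⟩ := hfin.exists_eq_pow_mul_and_not_dvd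
    exact ⟨_, f, h2, h1⟩
  have hN : |t1 * t4 - t2 * t3| * 3 = 3 ^ (r + 1) * |f| := by
    rw [hdf, abs_mul, abs_of_nonneg (by positivity : (0 : ℤ) ≤ 3 ^ r)]; ring
  have hPe : IsCoprime ((3 : ℤ) ^ (r + 1)) |f| :=
    IsCoprime.pow_left ((Int.prime_three.coprime_iff_not_dvd).2 (by rwa [dvd_abs]))
  have e1 : Lam1 3 ν t1 t2 t3 t4 = twoLat (t1 * t2 + t3 * t4) (t2 ^ 2 + t4 ^ 2)
      (ν * (t1 ^ 2 + t3 ^ 2)) (ν * (t1 * t2 + t3 * t4)) (3 ^ (r + 1) * |f|) := by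
    rw [← hN]; rfl
  have e2 : Lam2 3 ν t1 t2 t3 t4 = twoLat (t3 * t4 - t1 * t2) (t4 ^ 2 - t2 ^ 2)
      (ν * (t1 ^ 2 - t3 ^ 2)) (ν * (t1 * t2 - t3 * t4)) (3 ^ (r + 1) * |f|) := by
    rw [← hN]; rfl
  have e3 : Lam3 3 ν t1 t2 t3 t4 = twoLat (t2 * t3 + t1 * t4) (2 * t2 * t4)
      (ν * (2 * t1 * t3)) (ν * (t2 * t3 + t1 * t4)) (3 ^ (r + 1) * |f|) := by
    rw [← hN]; rfl
  rw [e1] at p1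
  rw [e2] at p2
  rw [e3] at p3
  rw [e1, e2, e3] at hcover
  have h0 : ∀ p : ℤ × ℤ, p ∈ Lam0 3 ν ↔ (3 : ℤ) ∣ p.1 := by
    intro p
    change ((3 : ℤ) ∣ 1 * p.1 + 0 * p.2 ∧ (3 : ℤ) ∣ 0 * p.1 + ν * p.2) ↔ _
    simp only [one_mul, zero_mul, zero_add, add_zero]
    exact ⟨fun h => h.1, fun h => ⟨h, hdvd.mul_right _⟩⟩
  by_cases hc : ∀ x, x ∈ twoLat (t1 * t2 + t3 * t4) (t2 ^ 2 + t4 ^ 2)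
      (ν * (t1 ^ 2 + t3 ^ 2)) (ν * (t1 * t2 + t3 * t4)) (3 ^ (r + 1) * |f|) ∨
      x ∈ twoLat (t3 * t4 - t1 * t2) (t4 ^ 2 - t2 ^ 2)
      (ν * (t1 ^ 2 - t3 ^ 2)) (ν * (t1 * t2 - t3 * t4)) (3 ^ (r + 1) * |f|) ∨
      x ∈ twoLat (t2 * t3 + t1 * t4) (2 * t2 * t4)
      (ν * (2 * t1 * t3)) (ν * (t2 * t3 + t1 * t4)) (3 ^ (r + 1) * |f|)
  · exact final_two ν t1 t2 t3 t4 hg r f hf hdf _ (Dvd.intro _ rfl)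
      (three_mem _ _ _ p2 p1 p3 (fun x => by have := hc x; tauto))
      (three_mem _ _ _ p1 p2 p3 hc)
      (three_mem _ _ _ p1 p3 p2 (fun x => by have := hc x; tauto))
  · push Not at hc
    obtain ⟨p, np1, np2, np3⟩ := hc
    have hp0 : (3 : ℤ) ∣ p.1 := by
      rw [← h0]; have := hcover p; tauto
    obtain ⟨u, v, huv⟩ := id hPe
    set b := v * |f| with hb
    have hPb : (3 : ℤ) ^ (r + 1) ∣ b - 1 := ⟨-u, by linear_combination huv⟩
    have heb : |f| ∣ b := Dvd.intro_left _ rfl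
    have h3b : (3 : ℤ) ∣ b - 1 := (dvd_pow_self 3 (by omega)).trans hPb
    set L1 := twoLat (t1 * t2 + t3 * t4) (t2 ^ 2 + t4 ^ 2)
      (ν * (t1 ^ 2 + t3 ^ 2)) (ν * (t1 * t2 + t3 * t4)) (3 ^ (r + 1)) with hL1
    set L2 := twoLat (t3 * t4 - t1 * t2) (t4 ^ 2 - t2 ^ 2)
      (ν * (t1 ^ 2 - t3 ^ 2)) (ν * (t1 * t2 - t3 * t4)) (3 ^ (r + 1)) with hL2
    set L3 := twoLat (t2 * t3 + t1 * t4) (2 * t2 * t4)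
      (ν * (2 * t1 * t3)) (ν * (t2 * t3 + t1 * t4)) (3 ^ (r + 1)) with hL3
    have hcov : ∀ x : ℤ × ℤ, x ∈ Lam0 3 ν ∨ (p ∉ L1 ∧ x ∈ L1) ∨ (p ∉ L2 ∧ x ∈ L2) ∨
        (p ∉ L3 ∧ x ∈ L3) := by
      intro x
      rcases hcover (p + b • (x - p)) with h | h | h | h
      · left
        rw [h0] at h ⊢
        simp only [Prod.fst_add, Prod.smul_fst, Prod.fst_sub, smul_eq_mul] at h
        have e : x.1 = (p.1 + b * (x.1 - p.1)) - (b - 1) * (x.1 - p.1) := by ring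
        rw [e]
        exact dvd_sub h (h3b.mul_right _)
      · exact Or.inr (Or.inl (transfer b _ _ hPb heb hPe _ _ _ _ p x np1 h))
      · exact Or.inr (Or.inr (Or.inl (transfer b _ _ hPb heb hPe _ _ _ _ p x np2 h)))
      · exact Or.inr (Or.inr (Or.inr (transfer b _ _ hPb heb hPe _ _ _ _ p x np3 h)))
    classical
    set K : Fin 4 → AddSubgroup (ℤ × ℤ) := ![Lam0 3 ν, L1, L2, L3] with hK
    set L : Fin 4 → AddSubgroup (ℤ × ℤ) := fun i => if p ∈ K i then Lam0 3 ν else K i with hL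
    have hpK0 : p ∈ K 0 := (h0 p).2 hp0
    have hL0 : L 0 = Lam0 3 ν := if_pos hpK0
    have h0s : ∀ z : ℤ × ℤ, (3 ^ (r + 1) : ℤ) • z ∈ Lam0 3 ν := by
      intro z
      rw [h0]
      exact (dvd_pow_self 3 (by omega)).mul_right _
    have h0t : Lam0 3 ν ≠ ⊤ := by
      intro h
      have : ((1, 0) : ℤ × ℤ) ∈ Lam0 3 ν := h ▸ AddSubgroup.mem_top _
      rw [h0] at this
      norm_num at this
    have hKs : ∀ i, ∀ z : ℤ × ℤ, (3 ^ (r + 1) : ℤ) • z ∈ K i := by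
      intro i z
      fin_cases i
      · exact h0s z
      · exact tl_smul _ _ _ _ _ _ dvd_rfl z
      · exact tl_smul _ _ _ _ _ _ dvd_rfl z
      · exact tl_smul _ _ _ _ _ _ dvd_rfl z
    obtain ⟨c1, c2⟩ := cover3 L (r + 1)
      (by
        intro i z
        by_cases hi : p ∈ K i
        · simp only [hL, if_pos hi]; exact h0s z
        · simp only [hL, if_neg hi]; exact hKs i z)
      (by
        intro i
        by_cases hi : p ∈ K i
        · simp only [hL, if_pos hi]; exact h0t
        · simp only [hL, if_neg hi]
          intro h
          exact hi (h ▸ AddSubgroup.mem_top _))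
      (by
        intro x
        rcases hcov x with h | ⟨hn, h⟩ | ⟨hn, h⟩ | ⟨hn, h⟩
        · exact ⟨0, by rw [hL0]; exact h⟩
        · exact ⟨1, by simp only [hL]; rw [if_neg (show p ∉ K 1 from hn)]; exact h⟩
        · exact ⟨2, by simp only [hL]; rw [if_neg (show p ∉ K 2 from hn)]; exact h⟩
        · exact ⟨3, by simp only [hL]; rw [if_neg (show p ∉ K 3 from hn)]; exact h⟩)
    have z0 : ((0, 1) : ℤ × ℤ) ∈ Lam0 3 ν := by rw [h0]; exact dvd_zero _
    have hnK : ∀ i, i ≠ 0 → L i = K i := by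
      intro i hi
      apply if_neg
      intro h
      have : L i = Lam0 3 ν := if_pos h
      exact hi (c2 i 0 (by rw [this]; exact z0) (by rw [hL0]; exact z0))
    refine final_three ν t1 t2 t3 t4 hdvd hg r f hf hdf L (hnK 1 (by decide)) (hnK 2 (by decide))
      (hnK 3 (by decide)) c1 ?_
    intro i hi h
    exact hi (c2 i 0 h (by rw [hL0]; exact z0))
end
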